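/- Let L > 0 and set λ = (2π/L)⁴. For every four times continuously differentiable L-periodic mean-zero function h : ℝ → ℝ and every twice continuously differentiable L-periodic mean-zero function v : ℝ → ℝ, the λ-convexity subgradient inequality holds: φ(h) − φ(v) ≤ −(λ/2) ∫₀ᴸ (h(x) − v(x))² dx + ∫₀ᴸ (d²/dx²)[sinh(h''(x))] · (h(x) − v(x)) dx. -/

import Mathlib

open MeasureTheory intervalIntegral

theorem Real.hasDerivAt_cosh_sub_sq_div_two (x : ℝ) :
    HasDerivAt (fun x : ℝ => Real.cosh x - x ^ 2 / 2) (Real.sinh x - x) x :=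
  ((Real.hasDerivAt_cosh x).fun_sub ((hasDerivAt_pow 2 x).div_const 2)).congr_deriv
    (by push_cast; ring)

theorem Real.convexOn_cosh_sub_sq_div_two :
    ConvexOn ℝ Set.univ (fun x : ℝ => Real.cosh x - x ^ 2 / 2) := by
  have hd : deriv (fun x : ℝ => Real.cosh x - x ^ 2 / 2) = fun x => Real.sinh x - x :=
    funext fun x => (Real.hasDerivAt_cosh_sub_sq_div_two x).deriv
  refine Monotone.convexOn_univ_of_deriv (by fun_prop) ?_
  rw [hd]
  exact Real.sinh_sub_id_strictMono.monotone

/-- Strong convexity of `cosh`, in the form of a quadratically improved tangent inequality. -/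
theorem Real.cosh_sub_cosh_le (a b : ℝ) :
    Real.cosh a - Real.cosh b ≤ Real.sinh a * (a - b) - (a - b) ^ 2 / 2 := by
  have hd := Real.hasDerivAt_cosh_sub_sq_div_two a
  have hc := Real.convexOn_cosh_sub_sq_div_two
  rcases lt_trichotomy a b with hab | rfl | hab
  · have := hc.le_slope_of_hasDerivAt (Set.mem_univ a) (Set.mem_univ b) hab hd
    rw [slope_def_field, le_div_iff₀ (by linarith)] at this
    linarith
  · simp
  · have := hc.slope_le_of_hasDerivAt (Set.mem_univ b) (Set.mem_univ a) hab hd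
    rw [slope_def_field, div_le_iff₀ (by linarith)] at this
    linarith

theorem Function.Periodic.deriv {f : ℝ → ℝ} {L : ℝ} (hf : Function.Periodic f L) :
    Function.Periodic (deriv f) L := by
  intro x
  rw [← deriv_comp_add_const, funext hf]

/-- The squared norm of a nonzero Fourier coefficient is controlled by that of the derivative. -/
theorem sq_norm_fourierCoeffOn_le_of_hasDerivAt {a b : ℝ} (hab : a < b) {f f' : ℝ → ℂ}
    (hf : ∀ x, HasDerivAt f (f' x) x) (hf' : Continuous f') (hp : f b = f a) {n : ℤ}
    (hn : n ≠ 0) :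
    (2 * Real.pi / (b - a)) ^ 2 * ‖fourierCoeffOn hab f n‖ ^ 2 ≤
      ‖fourierCoeffOn hab f' n‖ ^ 2 := by
  have hba : 0 < b - a := sub_pos.2 hab
  have hn1 : (1 : ℝ) ≤ |(n : ℝ)| := by exact_mod_cast Int.one_le_abs hn
  have key := fourierCoeffOn_of_hasDerivAt hab hn (fun x _ => hf x)
    (hf'.intervalIntegrable a b)
  have hnorm : ‖fourierCoeffOn hab f n‖ =
      (b - a) / (2 * Real.pi * |(n : ℝ)|) * ‖fourierCoeffOn hab f' n‖ := by
    rw [key, hp, sub_self, mul_zero, zero_sub, norm_mul, norm_neg, norm_mul, ← Complex.ofReal_sub,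
      Complex.norm_real, Real.norm_of_nonneg hba.le]
    simp [abs_of_pos Real.pi_pos]
    ring
  rw [← mul_pow, hnorm]
  refine pow_le_pow_left₀ (by positivity) ?_ 2
  have hpi := Real.pi_pos
  have heq : 2 * Real.pi / (b - a) *
      ((b - a) / (2 * Real.pi * |(n : ℝ)|) * ‖fourierCoeffOn hab f' n‖) =
      ‖fourierCoeffOn hab f' n‖ / |(n : ℝ)| := by
    field_simp
  rw [heq]
  exact div_le_self (norm_nonneg _) hn1

/-- **Wirtinger's inequality** for mean-zero functions with equal values at the endpoints. -/
theorem wirtinger_inequality {a b : ℝ} (hab : a < b) {f f' : ℝ → ℝ}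
    (hf : ∀ x, HasDerivAt f (f' x) x) (hf' : Continuous f') (hp : f b = f a)
    (hm : ∫ x in a..b, f x = 0) :
    (2 * Real.pi / (b - a)) ^ 2 * ∫ x in a..b, f x ^ 2 ≤ ∫ x in a..b, f' x ^ 2 := by
  have hba : 0 < b - a := sub_pos.2 hab
  have parseval : ∀ g : ℝ → ℝ, Continuous g →
      HasSum (fun i => ‖fourierCoeffOn hab (fun x => (g x : ℂ)) i‖ ^ 2)
        ((b - a)⁻¹ * ∫ x in a..b, g x ^ 2) := by
    intro g hg
    have hgc : Continuous (fun x => (g x : ℂ)) := Complex.continuous_ofReal.comp hg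
    have hL2 : MemLp (fun x => (g x : ℂ)) 2 (volume.restrict (Set.Ioc a b)) := by
      obtain ⟨C, hC⟩ := isCompact_Icc.exists_bound_of_continuousOn
        (hgc.continuousOn (s := Set.Icc a b))
      exact MemLp.of_bound hgc.aestronglyMeasurable C
        ((ae_restrict_mem measurableSet_Ioc).mono fun x hx => hC x (Set.Ioc_subset_Icc_self hx))
    simpa using hasSum_sq_fourierCoeffOn hab hL2
  have hcf : Continuous f := continuous_iff_continuousAt.2 fun x => (hf x).continuousAt
  have hle := hasSum_le (fun n => ?_) ((parseval f hcf).mul_left ((2 * Real.pi / (b - a)) ^ 2))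
    (parseval f' hf')
  · have := mul_le_mul_of_nonneg_left hle hba.le
    field_simp at this ⊢
    linarith
  · rcases eq_or_ne n 0 with rfl | hn
    · have h0 : fourierCoeffOn hab (fun x => (f x : ℂ)) 0 = 0 := by
        simp [fourierCoeffOn_eq_integral, intervalIntegral.integral_ofReal, hm]
      simp only [h0]
      simp
    · exact sq_norm_fourierCoeffOn_le_of_hasDerivAt hab (fun x => (hf x).ofReal_comp)
        (Complex.continuous_ofReal.comp hf') (by simp [hp]) hn

theorem wirtinger_inequality_second_order {L : ℝ} (hL : 0 < L) {f : ℝ → ℝ} (hf : ContDiff ℝ 2 f)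
    (hp : Function.Periodic f L) (hm : ∫ x in (0 : ℝ)..L, f x = 0) :
    (2 * Real.pi / L) ^ 4 * ∫ x in (0 : ℝ)..L, f x ^ 2 ≤
      ∫ x in (0 : ℝ)..L, deriv (deriv f) x ^ 2 := by
  have hf1 : ContDiff ℝ 1 (deriv f) := hf.deriv'
  have hd : ∀ x, HasDerivAt f (deriv f x) x := fun x =>
    (hf.differentiable (by norm_num) x).hasDerivAt
  have hd1 : ∀ x, HasDerivAt (deriv f) (deriv (deriv f) x) x := fun x =>
    (hf1.differentiable (by norm_num) x).hasDerivAt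
  have hm1 : ∫ x in (0 : ℝ)..L, deriv f x = 0 := by
    rw [integral_eq_sub_of_hasDerivAt (fun x _ => hd x) (hf1.continuous.intervalIntegrable _ _),
      hp.eq, sub_self]
  have h1 := wirtinger_inequality hL hd hf1.continuous hp.eq hm
  have h2 := wirtinger_inequality hL hd1 (hf1.continuous_deriv le_rfl) hp.deriv.eq hm1
  rw [sub_zero] at h1 h2
  calc (2 * Real.pi / L) ^ 4 * ∫ x in (0 : ℝ)..L, f x ^ 2
      = (2 * Real.pi / L) ^ 2 * ((2 * Real.pi / L) ^ 2 * ∫ x in (0 : ℝ)..L, f x ^ 2) := by ring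
    _ ≤ (2 * Real.pi / L) ^ 2 * ∫ x in (0 : ℝ)..L, deriv f x ^ 2 := by gcongr
    _ ≤ _ := h2

theorem Function.Periodic.integral_deriv_mul {u w : ℝ → ℝ} {L : ℝ} (hu : ContDiff ℝ 1 u)
    (hw : ContDiff ℝ 1 w) (hup : Function.Periodic u L) (hwp : Function.Periodic w L) :
    ∫ x in (0 : ℝ)..L, _root_.deriv u x * w x = -∫ x in (0 : ℝ)..L, u x * _root_.deriv w x := by
  rw [integral_mul_deriv_eq_deriv_mul
    (fun x _ => (hu.differentiable one_ne_zero x).hasDerivAt)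
    (fun x _ => (hw.differentiable one_ne_zero x).hasDerivAt)
    ((hu.continuous_deriv le_rfl).intervalIntegrable _ _)
    ((hw.continuous_deriv le_rfl).intervalIntegrable _ _), hup.eq, hwp.eq]
  ring

theorem Function.Periodic.integral_deriv_deriv_mul {u w : ℝ → ℝ} {L : ℝ} (hu : ContDiff ℝ 2 u)
    (hw : ContDiff ℝ 2 w) (hup : Function.Periodic u L) (hwp : Function.Periodic w L) :
    ∫ x in (0 : ℝ)..L, _root_.deriv (_root_.deriv u) x * w x =
      ∫ x in (0 : ℝ)..L, u x * _root_.deriv (_root_.deriv w) x := by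
  rw [hup.deriv.integral_deriv_mul hu.deriv' (hw.of_le one_le_two) hwp,
    hup.integral_deriv_mul (hu.of_le one_le_two) hw.deriv' hwp.deriv, neg_neg]

/-- λ-convexity subgradient inequality
φ(h) − φ(v) ≤ −(λ/2) ∫₀ᴸ (h−v)² + ∫₀ᴸ (sinh(h''))'' (h−v), with
φ(g) = ∫₀ᴸ cosh(g'') and λ = (2π/L)⁴. -/
theorem subgradient_inequality
    (L : ℝ) (hL : 0 < L)
    (h : ℝ → ℝ) (hh : ContDiff ℝ 4 h) (hhp : Function.Periodic h L)
    (hhm : ∫ x in (0:ℝ)..L, h x = 0)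
    (v : ℝ → ℝ) (hv : ContDiff ℝ 2 v) (hvp : Function.Periodic v L)
    (hvm : ∫ x in (0:ℝ)..L, v x = 0) :
    (∫ x in (0:ℝ)..L, Real.cosh (deriv (deriv h) x))
        - (∫ x in (0:ℝ)..L, Real.cosh (deriv (deriv v) x))
      ≤ - ((2 * Real.pi / L) ^ 4 / 2) * (∫ x in (0:ℝ)..L, (h x - v x) ^ 2)
        + ∫ x in (0:ℝ)..L,
            deriv (deriv (fun y => Real.sinh (deriv (deriv h) y))) x
              * (h x - v x) := by
  have hh2 : ContDiff ℝ 2 h := hh.of_le (by norm_num)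
  have hh'' : ContDiff ℝ 2 (deriv (deriv h)) := by
    have h3 : ContDiff ℝ 3 (deriv h) := ContDiff.deriv' hh
    exact ContDiff.deriv' h3
  have hv'' : Continuous (deriv (deriv v)) :=
    (ContDiff.deriv' hv : ContDiff ℝ 1 (deriv v)).continuous_deriv le_rfl
  have hw : ContDiff ℝ 2 (fun x => h x - v x) := hh2.sub hv
  have hwp : Function.Periodic (fun x => h x - v x) L := hhp.sub hvp
  have hwm : ∫ x in (0 : ℝ)..L, (h x - v x) = 0 := by
    rw [integral_sub (hh.continuous.intervalIntegrable _ _)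
      (hv.continuous.intervalIntegrable _ _), hhm, hvm, sub_zero]
  have hw1 : deriv (fun x => h x - v x) = fun x => deriv h x - deriv v x := funext fun x =>
    deriv_fun_sub (hh2.differentiable two_ne_zero x) (hv.differentiable two_ne_zero x)
  have hw2 : deriv (deriv (fun x => h x - v x)) =
      fun x => deriv (deriv h) x - deriv (deriv v) x := by
    rw [hw1]
    exact funext fun x => deriv_fun_sub
      ((ContDiff.deriv' hh2 : ContDiff ℝ 1 (deriv h)).differentiable one_ne_zero x)
      ((ContDiff.deriv' hv : ContDiff ℝ 1 (deriv v)).differentiable one_ne_zero x)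
  have hs : ContDiff ℝ 2 (fun y => Real.sinh (deriv (deriv h) y)) := hh''.sinh
  have hsp : Function.Periodic (fun y => Real.sinh (deriv (deriv h) y)) L :=
    hhp.deriv.deriv.comp Real.sinh
  have hwirt := wirtinger_inequality_second_order hL hw hwp hwm
  rw [hsp.integral_deriv_deriv_mul hs hw hwp]
  rw [hw2] at hwirt ⊢
  have hc := hh''.continuous
  have hmono : ∫ x in (0 : ℝ)..L, (Real.cosh (deriv (deriv h) x) - Real.cosh (deriv (deriv v) x)) ≤
      ∫ x in (0 : ℝ)..L, (Real.sinh (deriv (deriv h) x) * (deriv (deriv h) x - deriv (deriv v) x)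
        - (deriv (deriv h) x - deriv (deriv v) x) ^ 2 / 2) :=
    integral_mono hL.le (Continuous.intervalIntegrable (by fun_prop) _ _)
      (Continuous.intervalIntegrable (by fun_prop) _ _)
      fun x => Real.cosh_sub_cosh_le _ _
  rw [integral_sub (Continuous.intervalIntegrable (by fun_prop) _ _)
      (Continuous.intervalIntegrable (by fun_prop) _ _),
    integral_sub (Continuous.intervalIntegrable (by fun_prop) _ _)
      (Continuous.intervalIntegrable (by fun_prop) _ _), intervalIntegral.integral_div] at hmono
  linarith
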